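/- For every h-normal Γ-linear connection of Cartan type, the following local Bianchi identities hold for all indices l, j, k, p: (7) (Pv^l_1p)_|k − (Pv^l_kp)_/1 + Pv^l_kr Pv^r_1p − Pv^l_1r Pv^r_kp = (Rv^l_1k)|_(p) − R^l_p1k + Rv^l_1r C^r_kp − T^r_1k Pv^l_rp, and (8) A_{j,k}{ Rv^l_jr C^r_kp + Pv^l_jr Pv^r_kp + (Pv^l_kp)_|j } = R^l_pjk − (Rv^l_jk)|_(p). -/

import Mathlib

open Finset

noncomputable section

namespace Jet

/-- Smooth real-valued functions of `(t, x, y) ∈ ℝ × ℝⁿ × ℝⁿ`, the local coordinates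
of the 1-jet space `J¹(ℝ, M)`. -/
abbrev Fn (n : ℕ) : Type := ℝ → (Fin n → ℝ) → (Fin n → ℝ) → ℝ

def Smooth {n : ℕ} (F : Fn n) : Prop :=
  ContDiff ℝ (⊤ : ℕ∞) (fun p : ℝ × (Fin n → ℝ) × (Fin n → ℝ) => F p.1 p.2.1 p.2.2)

/-- Partial derivative in the time variable `t`. -/
def pt {n : ℕ} (F : Fn n) : Fn n := fun t x y => deriv (fun s => F s x y) t

/-- Partial derivative in the spatial variable `xⁱ`. -/
def px {n : ℕ} (i : Fin n) (F : Fn n) : Fn n :=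
  fun t x y => deriv (fun s => F t (Function.update x i s) y) (x i)

/-- Partial derivative in the fibre variable `yⁱ`. -/
def py {n : ℕ} (i : Fin n) (F : Fn n) : Fn n :=
  fun t x y => deriv (fun s => F t x (Function.update y i s)) (y i)

/-- Kronecker delta, as a constant function on the jet space. -/
def kron {n : ℕ} (i j : Fin n) : Fn n := if i = j then 1 else 0

/-- The coordinate function `yⁱ`. -/
def yc {n : ℕ} (i : Fin n) : Fn n := fun _ _ y => y i

/-- The Christoffel symbol `κ(t) = (1/(2h)) dh/dt` of a Riemannian metric `h` on `ℝ`,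
as a function on the jet space. -/
def chr {n : ℕ} (h : ℝ → ℝ) : Fn n := fun t _ _ => deriv h t / (2 * h t)

/-- The metric `h(t)` as a function on the jet space. -/
def hfun {n : ℕ} (h : ℝ → ℝ) : Fn n := fun t _ _ => h t

/-- The derivative `dh/dt` as a function on the jet space. -/
def hder {n : ℕ} (h : ℝ → ℝ) : Fn n := fun t _ _ => deriv h t

variable {n : ℕ}

/-- The adapted temporal derivative `δ/δt = ∂/∂t − Mʳ ∂/∂yʳ` determined by a
nonlinear connection `(M, N)`. -/
def dt (M : Fin n → Fn n) (F : Fn n) : Fn n := pt F - ∑ r, M r * py r F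

/-- The adapted spatial derivative `δ/δxᵏ = ∂/∂xᵏ − Nʳₖ ∂/∂yʳ`. -/
def dx (N : Fin n → Fin n → Fn n) (k : Fin n) (F : Fn n) : Fn n :=
  px k F - ∑ r, N r k * py r F

/-- An `h`-normal `Γ`-linear connection `(κ, Gᵏᵢ, Lᵏᵢⱼ, Cᵏᵢⱼ)`. -/
structure Conn (n : ℕ) where
  κ : Fn n
  G : Fin n → Fin n → Fn n
  L : Fin n → Fin n → Fin n → Fn n
  C : Fin n → Fin n → Fin n → Fn n

/-! ### Torsion d-tensors -/

/-- `Tʳ₁ⱼ = −Gʳⱼ`. -/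
def T1 (Γ : Conn n) (r j : Fin n) : Fn n := -Γ.G r j

/-- `Rvʳ₁ⱼ = (δ/δxʲ)Mʳ − (δ/δt)Nʳⱼ`. -/
def Rv1 (M : Fin n → Fn n) (N : Fin n → Fin n → Fn n) (r j : Fin n) : Fn n :=
  dx N j (M r) - dt M (N r j)

/-- `Tʳᵢⱼ = Lʳᵢⱼ − Lʳⱼᵢ`. -/
def Tsp (Γ : Conn n) (r i j : Fin n) : Fn n := Γ.L r i j - Γ.L r j i

/-- `Rvʳᵢⱼ = (δ/δxʲ)Nʳᵢ − (δ/δxⁱ)Nʳⱼ`. -/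
def Rvsp (M : Fin n → Fn n) (N : Fin n → Fin n → Fn n) (r i j : Fin n) : Fn n :=
  dx N j (N r i) - dx N i (N r j)

/-- `Pvʳ₁ⱼ = ∂Mʳ/∂yʲ − Gʳⱼ + δʳⱼ κ`. -/
def Pv1 (M : Fin n → Fn n) (Γ : Conn n) (r j : Fin n) : Fn n :=
  py j (M r) - Γ.G r j + kron r j * Γ.κ

/-- `Phʳᵢⱼ = Cʳᵢⱼ`. -/
def Phsp (Γ : Conn n) (r i j : Fin n) : Fn n := Γ.C r i j

/-- `Pvʳᵢⱼ = ∂Nʳᵢ/∂yʲ − Lʳⱼᵢ`. -/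
def Pvsp (N : Fin n → Fin n → Fn n) (Γ : Conn n) (r i j : Fin n) : Fn n :=
  py j (N r i) - Γ.L r j i

/-- `Sʳᵢⱼ = Cʳᵢⱼ − Cʳⱼᵢ`. -/
def Ssp (Γ : Conn n) (r i j : Fin n) : Fn n := Γ.C r i j - Γ.C r j i

/-! ### Generic covariant derivatives of d-tensors -/

/-- Index types of the (valued) indices of a d-tensor: upper/lower spatial,
upper/lower vertical.  (Temporal indices carry no value; they are accounted for by the
temporal weight `p` = number of upper temporal indices minus number of lower temporal
indices.) -/
inductive IdxType | uS | lS | uV | lV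

/-- A d-tensor component family with `m` valued indices. -/
abbrev Tensor (n m : ℕ) := (Fin m → Fin n) → Fn n

/-- The `ℝ`-horizontal covariant derivative `D_{/1}` of a d-tensor `D` with valued index
signature `σ` and temporal weight `p`. -/
def covT {m : ℕ} (M : Fin n → Fn n) (Γ : Conn n) (p : ℤ) (σ : Fin m → IdxType)
    (D : Tensor n m) : Tensor n m := fun a =>
  dt M (D a) + p • (Γ.κ * D a)
    + ∑ q : Fin m,
      (match σ q with
      | .uS => ∑ r, D (Function.update a q r) * Γ.G (a q) r
      | .lS => -∑ r, D (Function.update a q r) * Γ.G r (a q)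
      | .uV => ∑ r, D (Function.update a q r) * (Γ.G (a q) r - kron (a q) r * Γ.κ)
      | .lV => -∑ r, D (Function.update a q r) * (Γ.G r (a q) - kron r (a q) * Γ.κ) : Fn n)

/-- The `M`-horizontal covariant derivative `D_{|k}`. -/
def covX {m : ℕ} (N : Fin n → Fin n → Fn n) (Γ : Conn n) (σ : Fin m → IdxType)
    (k : Fin n) (D : Tensor n m) : Tensor n m := fun a =>
  dx N k (D a)
    + ∑ q : Fin m,
      (match σ q with
      | .uS => ∑ r, D (Function.update a q r) * Γ.L (a q) r k
      | .uV => ∑ r, D (Function.update a q r) * Γ.L (a q) r k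
      | .lS => -∑ r, D (Function.update a q r) * Γ.L r (a q) k
      | .lV => -∑ r, D (Function.update a q r) * Γ.L r (a q) k : Fn n)

/-- The vertical covariant derivative `D|_{(k)}`. -/
def covY {m : ℕ} (Γ : Conn n) (σ : Fin m → IdxType)
    (k : Fin n) (D : Tensor n m) : Tensor n m := fun a =>
  py k (D a)
    + ∑ q : Fin m,
      (match σ q with
      | .uS => ∑ r, D (Function.update a q r) * Γ.C (a q) r k
      | .uV => ∑ r, D (Function.update a q r) * Γ.C (a q) r k
      | .lS => -∑ r, D (Function.update a q r) * Γ.C r (a q) k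
      | .lV => -∑ r, D (Function.update a q r) * Γ.C r (a q) k : Fn n)

/-- The coefficients `Cᵏᵢⱼ` viewed as a d-tensor with signature
(upper spatial, lower spatial, lower vertical). -/
def CT (Γ : Conn n) : Tensor n 3 := fun a => Γ.C (a 0) (a 1) (a 2)

/-- The signature of `Cᵏᵢⱼ`. -/
def sigC : Fin 3 → IdxType := ![IdxType.uS, IdxType.lS, IdxType.lV]

/-! ### Curvature d-tensors -/

/-- `Rˡᵢ₁ₖ`. -/
def Rc1 (M : Fin n → Fn n) (N : Fin n → Fin n → Fn n) (Γ : Conn n) (l i k : Fin n) : Fn n :=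
  dx N k (Γ.G l i) - dt M (Γ.L l i k) + ∑ r, Γ.G r i * Γ.L l r k
    - ∑ r, Γ.L r i k * Γ.G l r + ∑ r, Γ.C l i r * Rv1 M N r k

/-- `Rˡᵢⱼₖ`. -/
def Rc (M : Fin n → Fn n) (N : Fin n → Fin n → Fn n) (Γ : Conn n) (l i j k : Fin n) : Fn n :=
  dx N k (Γ.L l i j) - dx N j (Γ.L l i k) + ∑ r, Γ.L r i j * Γ.L l r k
    - ∑ r, Γ.L r i k * Γ.L l r j + ∑ r, Γ.C l i r * Rvsp M N r j k

/-- `Pˡᵢ₁₍ₖ₎`. -/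
def Pc1 (M : Fin n → Fn n) (N : Fin n → Fin n → Fn n) (Γ : Conn n) (l i k : Fin n) : Fn n :=
  py k (Γ.G l i) - covT M Γ 0 sigC (CT Γ) ![l, i, k] + ∑ r, Γ.C l i r * Pv1 M Γ r k

/-- `Pˡᵢⱼ₍ₖ₎`. -/
def Pc (M : Fin n → Fn n) (N : Fin n → Fin n → Fn n) (Γ : Conn n) (l i j k : Fin n) : Fn n :=
  py k (Γ.L l i j) - covX N Γ sigC j (CT Γ) ![l, i, k] + ∑ r, Γ.C l i r * Pvsp N Γ r j k

/-- `Sˡᵢ₍ⱼ₎₍ₖ₎`. -/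
def Sc (Γ : Conn n) (l i j k : Fin n) : Fn n :=
  py k (Γ.C l i j) - py j (Γ.C l i k)
    + ∑ r, Γ.C r i j * Γ.C l r k - ∑ r, Γ.C r i k * Γ.C l r j

end Jet

namespace Jet

variable {n : ℕ}

/-- A family with one valued index, viewed as a d-tensor. -/
def famT (X : Fin n → Fn n) : Tensor n 1 := fun a => X (a 0)

def T1T (Γ : Conn n) : Tensor n 2 := fun a => T1 Γ (a 0) (a 1)
def Rv1T (M : Fin n → Fn n) (N : Fin n → Fin n → Fn n) : Tensor n 2 :=
  fun a => Rv1 M N (a 0) (a 1)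
def RvspT (M : Fin n → Fn n) (N : Fin n → Fin n → Fn n) : Tensor n 3 :=
  fun a => Rvsp M N (a 0) (a 1) (a 2)
def Pv1T (M : Fin n → Fn n) (Γ : Conn n) : Tensor n 2 := fun a => Pv1 M Γ (a 0) (a 1)
def PvspT (N : Fin n → Fin n → Fn n) (Γ : Conn n) : Tensor n 3 :=
  fun a => Pvsp N Γ (a 0) (a 1) (a 2)
def Rc1T (M : Fin n → Fn n) (N : Fin n → Fin n → Fn n) (Γ : Conn n) : Tensor n 3 :=
  fun a => Rc1 M N Γ (a 0) (a 1) (a 2)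
def RcT (M : Fin n → Fn n) (N : Fin n → Fin n → Fn n) (Γ : Conn n) : Tensor n 4 :=
  fun a => Rc M N Γ (a 0) (a 1) (a 2) (a 3)
def Pc1T (M : Fin n → Fn n) (N : Fin n → Fin n → Fn n) (Γ : Conn n) : Tensor n 3 :=
  fun a => Pc1 M N Γ (a 0) (a 1) (a 2)
def PcT (M : Fin n → Fn n) (N : Fin n → Fin n → Fn n) (Γ : Conn n) : Tensor n 4 :=
  fun a => Pc M N Γ (a 0) (a 1) (a 2) (a 3)
def ScT (Γ : Conn n) : Tensor n 4 := fun a => Sc Γ (a 0) (a 1) (a 2) (a 3)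

/-- valued-index signatures (temporal indices are tracked by the weight `p` only) -/
def sig0 : Fin 0 → IdxType := ![]
def siglS : Fin 1 → IdxType := ![IdxType.lS]
def siglV : Fin 1 → IdxType := ![IdxType.lV]
def sigU : Fin 1 → IdxType := ![IdxType.uS]
def sigV : Fin 1 → IdxType := ![IdxType.uV]
def sigUlS : Fin 2 → IdxType := ![IdxType.uS, IdxType.lS]
def sigUlV : Fin 2 → IdxType := ![IdxType.uS, IdxType.lV]
def sigVlS : Fin 2 → IdxType := ![IdxType.uV, IdxType.lS]
def sigVlV : Fin 2 → IdxType := ![IdxType.uV, IdxType.lV]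
def sigRvsp : Fin 3 → IdxType := ![IdxType.uV, IdxType.lS, IdxType.lS]
def sigPvsp : Fin 3 → IdxType := ![IdxType.uV, IdxType.lS, IdxType.lV]
def sigRc1 : Fin 3 → IdxType := ![IdxType.uS, IdxType.lS, IdxType.lS]
def sigRc : Fin 4 → IdxType := ![IdxType.uS, IdxType.lS, IdxType.lS, IdxType.lS]
def sigPc1 : Fin 3 → IdxType := ![IdxType.uS, IdxType.lS, IdxType.lV]
def sigPc : Fin 4 → IdxType := ![IdxType.uS, IdxType.lS, IdxType.lS, IdxType.lV]
def sigSc : Fin 4 → IdxType := ![IdxType.uS, IdxType.lS, IdxType.lV, IdxType.lV]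

end Jet

namespace Jet

variable {n : ℕ}

/-- A function of `(t, x, y)` as a function on the product space. -/
def uncurried (F : Fn n) : ℝ × (Fin n → ℝ) × (Fin n → ℝ) → ℝ :=
  fun p => F p.1 p.2.1 p.2.2

/-- The derivative of `F` in the constant direction `v`. -/
def dirDeriv (v : ℝ × (Fin n → ℝ) × (Fin n → ℝ)) (F : Fn n) : Fn n :=
  fun t x y => fderiv ℝ (uncurried F) (t, x, y) v

/-- The adapted derivative `∂_v − Wʳ ∂/∂yʳ`. -/
def adapted (v : ℝ × (Fin n → ℝ) × (Fin n → ℝ)) (W : Fin n → Fn n) (F : Fn n) : Fn n :=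
  dirDeriv v F - ∑ r, W r * dirDeriv (0, 0, Pi.single r 1) F

theorem Smooth.differentiableAt {F : Fn n} (hF : Smooth F)
    (p : ℝ × (Fin n → ℝ) × (Fin n → ℝ)) : DifferentiableAt ℝ (uncurried F) p :=
  (ContDiff.differentiable hF (by simp)) p

protected theorem Smooth.sub {F G : Fn n} (hF : Smooth F) (hG : Smooth G) : Smooth (F - G) :=
  ContDiff.sub hF hG

protected theorem Smooth.add {F G : Fn n} (hF : Smooth F) (hG : Smooth G) : Smooth (F + G) :=
  ContDiff.add hF hG

protected theorem Smooth.mul {F G : Fn n} (hF : Smooth F) (hG : Smooth G) : Smooth (F * G) :=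
  ContDiff.mul hF hG

protected theorem Smooth.sum {ι : Type*} (s : Finset ι) {F : ι → Fn n} (hF : ∀ i, Smooth (F i)) :
    Smooth (∑ i ∈ s, F i) := by
  have := ContDiff.sum (s := s) (fun i _ => hF i)
  simpa [Smooth, Finset.sum_apply] using this

protected theorem Smooth.kron (i j : Fin n) : Smooth (kron i j : Fn n) := by
  unfold Jet.kron
  split_ifs
  · exact contDiff_const (c := (1 : ℝ))
  · exact contDiff_const (c := (0 : ℝ))

protected theorem Smooth.dirDeriv {F : Fn n} (hF : Smooth F) (v : ℝ × (Fin n → ℝ) × (Fin n → ℝ)) :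
    Smooth (dirDeriv v F) :=
  (ContDiff.fderiv_right (m := (⊤ : ℕ∞)) hF (by simp)).clm_apply contDiff_const

protected theorem Smooth.adapted {F : Fn n} {W : Fin n → Fn n} (hF : Smooth F) (hW : ∀ r, Smooth (W r))
    (v : ℝ × (Fin n → ℝ) × (Fin n → ℝ)) : Smooth (adapted v W F) :=
  (hF.dirDeriv v).sub (Smooth.sum _ fun r => (hW r).mul (hF.dirDeriv _))

theorem smooth_chr {h : ℝ → ℝ} (hh : ContDiff ℝ (⊤ : ℕ∞) h) (hpos : ∀ t, 0 < h t) :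
    Smooth (chr h : Fn n) := by
  have hd : ContDiff ℝ (⊤ : ℕ∞) (deriv h) := (contDiff_infty_iff_deriv.1 hh).2
  have : ContDiff ℝ (⊤ : ℕ∞) (fun t => deriv h t / (2 * h t)) :=
    hd.div (contDiff_const.mul hh) fun t => (mul_pos two_pos (hpos t)).ne'
  exact this.comp contDiff_fst

theorem dirDeriv_sub (v : ℝ × (Fin n → ℝ) × (Fin n → ℝ)) {F G : Fn n}
    (hF : Smooth F) (hG : Smooth G) : dirDeriv v (F - G) = dirDeriv v F - dirDeriv v G := by
  funext t x y
  change fderiv ℝ (uncurried F - uncurried G) _ v = _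
  rw [fderiv_sub (hF.differentiableAt _) (hG.differentiableAt _)]
  rfl

theorem dirDeriv_add (v : ℝ × (Fin n → ℝ) × (Fin n → ℝ)) {F G : Fn n}
    (hF : Smooth F) (hG : Smooth G) : dirDeriv v (F + G) = dirDeriv v F + dirDeriv v G := by
  funext t x y
  change fderiv ℝ (uncurried F + uncurried G) _ v = _
  rw [fderiv_add (hF.differentiableAt _) (hG.differentiableAt _)]
  rfl

theorem dirDeriv_mul (v : ℝ × (Fin n → ℝ) × (Fin n → ℝ)) {F G : Fn n}
    (hF : Smooth F) (hG : Smooth G) :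
    dirDeriv v (F * G) = F * dirDeriv v G + dirDeriv v F * G := by
  funext t x y
  change fderiv ℝ (uncurried F * uncurried G) _ v = _
  rw [fderiv_mul (hF.differentiableAt _) (hG.differentiableAt _)]
  simp [dirDeriv, uncurried, mul_comm]

theorem dirDeriv_sum (v : ℝ × (Fin n → ℝ) × (Fin n → ℝ)) {ι : Type*} (s : Finset ι)
    {F : ι → Fn n} (hF : ∀ i, Smooth (F i)) :
    dirDeriv v (∑ i ∈ s, F i) = ∑ i ∈ s, dirDeriv v (F i) := by
  classical
  induction s using Finset.induction_on with
  | empty =>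
    funext t x y
    change fderiv ℝ (fun _ => (0 : ℝ)) _ v = 0
    simp
  | insert a s ha ih =>
    rw [Finset.sum_insert ha, Finset.sum_insert ha, dirDeriv_add v (hF a) (Smooth.sum s hF), ih]

theorem dirDeriv_comm (v w : ℝ × (Fin n → ℝ) × (Fin n → ℝ)) {F : Fn n} (hF : Smooth F) :
    dirDeriv v (dirDeriv w F) = dirDeriv w (dirDeriv v F) := by
  have hd : ContDiff ℝ (⊤ : ℕ∞) (fderiv ℝ (uncurried F)) := ContDiff.fderiv_right hF (by simp)
  have key : ∀ (a b p : ℝ × (Fin n → ℝ) × (Fin n → ℝ)),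
      fderiv ℝ (fun q => fderiv ℝ (uncurried F) q b) p a
        = fderiv ℝ (fderiv ℝ (uncurried F)) p a b := by
    intro a b p
    rw [fderiv_clm_apply (hd.differentiable (by simp) p) (differentiableAt_const b)]
    simp
  funext t x y
  have hs : IsSymmSndFDerivAt ℝ (uncurried F) (t, x, y) :=
    (ContDiff.contDiffAt hF).isSymmSndFDerivAt (by
      rw [minSmoothness_of_isRCLikeNormedField]
      exact WithTop.coe_le_coe.2 (le_top (a := (2 : ℕ∞))))
  exact (key v w _).trans ((hs.eq v w).trans (key w v _).symm)

theorem adapted_sub (v : ℝ × (Fin n → ℝ) × (Fin n → ℝ)) (W : Fin n → Fn n) {F G : Fn n}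
    (hF : Smooth F) (hG : Smooth G) :
    adapted v W (F - G) = adapted v W F - adapted v W G := by
  simp only [adapted, dirDeriv_sub _ hF hG, mul_sub, Finset.sum_sub_distrib]
  ring

theorem adapted_add (v : ℝ × (Fin n → ℝ) × (Fin n → ℝ)) (W : Fin n → Fn n) {F G : Fn n}
    (hF : Smooth F) (hG : Smooth G) :
    adapted v W (F + G) = adapted v W F + adapted v W G := by
  simp only [adapted, dirDeriv_add _ hF hG, mul_add, Finset.sum_add_distrib]
  ring

/-- Commutator of a fibre derivative with an adapted derivative. -/
theorem dirDeriv_adapted (p : Fin n) (v : ℝ × (Fin n → ℝ) × (Fin n → ℝ)) {W : Fin n → Fn n}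
    {F : Fn n} (hF : Smooth F) (hW : ∀ r, Smooth (W r)) :
    dirDeriv (0, 0, Pi.single p 1) (adapted v W F)
      = adapted v W (dirDeriv (0, 0, Pi.single p 1) F)
        - ∑ r, dirDeriv (0, 0, Pi.single p 1) (W r) * dirDeriv (0, 0, Pi.single r 1) F := by
  unfold adapted
  rw [dirDeriv_sub _ (hF.dirDeriv v) (Smooth.sum _ fun r => (hW r).mul (hF.dirDeriv _)),
    dirDeriv_sum _ _ (fun r => (hW r).mul (hF.dirDeriv _)), dirDeriv_comm _ v hF]
  simp only [dirDeriv_mul _ (hW _) (hF.dirDeriv _), Finset.sum_add_distrib,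
    dirDeriv_comm (0, 0, Pi.single p 1) _ hF]
  ring

theorem Smooth.pt_eq {F : Fn n} (hF : Smooth F) : pt F = dirDeriv (1, 0, 0) F := by
  funext t x y
  have h : HasDerivAt (fun s : ℝ => (s, x, y)) (1, 0, 0) t :=
    (hasDerivAt_id t).prodMk ((hasDerivAt_const t x).prodMk (hasDerivAt_const t y))
  exact ((hF.differentiableAt (t, x, y)).hasFDerivAt.comp_hasDerivAt t h).deriv

theorem Smooth.px_eq {F : Fn n} (hF : Smooth F) (i : Fin n) :
    px i F = dirDeriv (0, Pi.single i 1, 0) F := by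
  funext t x y
  have h : HasDerivAt (fun s : ℝ => (t, Function.update x i s, y)) (0, Pi.single i 1, 0) (x i) :=
    (hasDerivAt_const _ t).prodMk ((hasDerivAt_update x i _).prodMk (hasDerivAt_const _ y))
  have hd := hF.differentiableAt (t, Function.update x i (x i), y)
  have := (hd.hasFDerivAt.comp_hasDerivAt (x i) h).deriv
  rw [Function.update_eq_self] at this
  exact this

theorem Smooth.py_eq {F : Fn n} (hF : Smooth F) (i : Fin n) :
    py i F = dirDeriv (0, 0, Pi.single i 1) F := by
  funext t x y
  have h : HasDerivAt (fun s : ℝ => (t, x, Function.update y i s)) (0, 0, Pi.single i 1) (y i) :=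
    (hasDerivAt_const _ t).prodMk ((hasDerivAt_const _ x).prodMk (hasDerivAt_update y i _))
  have hd := hF.differentiableAt (t, x, Function.update y i (y i))
  have := (hd.hasFDerivAt.comp_hasDerivAt (y i) h).deriv
  rw [Function.update_eq_self] at this
  exact this

protected theorem Smooth.py {F : Fn n} (hF : Smooth F) (i : Fin n) : Smooth (py i F) := by
  rw [hF.py_eq]
  exact hF.dirDeriv _

theorem Smooth.dt_eq {F : Fn n} (hF : Smooth F) (M : Fin n → Fn n) :
    dt M F = adapted (1, 0, 0) M F := by
  simp only [dt, adapted, hF.pt_eq, hF.py_eq]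

theorem Smooth.dx_eq {F : Fn n} (hF : Smooth F) (N : Fin n → Fin n → Fn n) (k : Fin n) :
    dx N k F = adapted (0, Pi.single k 1, 0) (fun r => N r k) F := by
  simp only [dx, adapted, hF.px_eq, hF.py_eq]

protected theorem Smooth.dt {F : Fn n} {M : Fin n → Fn n} (hF : Smooth F) (hM : ∀ r, Smooth (M r)) :
    Smooth (dt M F) := by
  rw [hF.dt_eq]
  exact hF.adapted hM _

protected theorem Smooth.dx {F : Fn n} {N : Fin n → Fin n → Fn n} (hF : Smooth F)
    (hN : ∀ r j, Smooth (N r j)) (k : Fin n) : Smooth (dx N k F) := by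
  rw [hF.dx_eq]
  exact hF.adapted (fun r => hN r k) _

theorem py_sub (i : Fin n) {F G : Fn n} (hF : Smooth F) (hG : Smooth G) :
    py i (F - G) = py i F - py i G := by
  rw [(hF.sub hG).py_eq, hF.py_eq, hG.py_eq, dirDeriv_sub _ hF hG]

theorem dt_sub (M : Fin n → Fn n) {F G : Fn n} (hF : Smooth F) (hG : Smooth G) :
    dt M (F - G) = dt M F - dt M G := by
  rw [(hF.sub hG).dt_eq, hF.dt_eq, hG.dt_eq, adapted_sub _ _ hF hG]

theorem dx_sub (N : Fin n → Fin n → Fn n) (k : Fin n) {F G : Fn n}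
    (hF : Smooth F) (hG : Smooth G) : dx N k (F - G) = dx N k F - dx N k G := by
  rw [(hF.sub hG).dx_eq, hF.dx_eq, hG.dx_eq, adapted_sub _ _ hF hG]

theorem dx_add (N : Fin n → Fin n → Fn n) (k : Fin n) {F G : Fn n}
    (hF : Smooth F) (hG : Smooth G) : dx N k (F + G) = dx N k F + dx N k G := by
  rw [(hF.add hG).dx_eq, hF.dx_eq, hG.dx_eq, adapted_add _ _ hF hG]

theorem py_dt (p : Fin n) {M : Fin n → Fn n} {F : Fn n} (hF : Smooth F)
    (hM : ∀ r, Smooth (M r)) :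
    py p (dt M F) = dt M (py p F) - ∑ r, py p (M r) * py r F := by
  rw [(hF.dt hM).py_eq, (hF.py p).dt_eq, hF.dt_eq]
  simp only [hF.py_eq, (hM _).py_eq]
  exact dirDeriv_adapted p _ hF hM

theorem py_dx (p k : Fin n) {N : Fin n → Fin n → Fn n} {F : Fn n} (hF : Smooth F)
    (hN : ∀ r j, Smooth (N r j)) :
    py p (dx N k F) = dx N k (py p F) - ∑ r, py p (N r k) * py r F := by
  rw [(hF.dx hN k).py_eq, (hF.py p).dx_eq, hF.dx_eq]
  simp only [hF.py_eq, (hN _ _).py_eq]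
  exact dirDeriv_adapted p _ hF fun r => hN r k

theorem dx_kron_mul_chr (N : Fin n → Fin n → Fn n) (k i j : Fin n) (h : ℝ → ℝ) :
    dx N k (kron i j * chr h) = 0 := by
  have hx : px k (kron i j * chr h : Fn n) = 0 := by
    funext t x y
    unfold kron
    split_ifs <;> simp [px, chr]
  have hy : ∀ r, py r (kron i j * chr h : Fn n) = 0 := by
    intro r
    funext t x y
    unfold kron
    split_ifs <;> simp [py, chr]
  simp [dx, hx, hy]

theorem covX_Pv1T (M : Fin n → Fn n) (N : Fin n → Fin n → Fn n) (Γ : Conn n) (l p k : Fin n) :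
    covX N Γ sigVlV k (Pv1T M Γ) ![l, p]
      = dx N k (Pv1 M Γ l p) + ∑ r, Pv1 M Γ r p * Γ.L l r k - ∑ r, Pv1 M Γ l r * Γ.L r p k := by
  simp [covX, sigVlV, Pv1T, Fin.sum_univ_succ]
  ring

theorem covX_PvspT (N : Fin n → Fin n → Fn n) (Γ : Conn n) (l i p k : Fin n) :
    covX N Γ sigPvsp k (PvspT N Γ) ![l, i, p]
      = dx N k (Pvsp N Γ l i p) + ∑ r, Pvsp N Γ r i p * Γ.L l r k
        - ∑ r, Pvsp N Γ l r p * Γ.L r i k - ∑ r, Pvsp N Γ l i r * Γ.L r p k := by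
  simp [covX, sigPvsp, PvspT, Fin.sum_univ_succ]
  ring

theorem covT_PvspT (M : Fin n → Fn n) (N : Fin n → Fin n → Fn n) (Γ : Conn n) (l k p : Fin n) :
    covT M Γ 0 sigPvsp (PvspT N Γ) ![l, k, p]
      = dt M (Pvsp N Γ l k p) + ∑ r, Pvsp N Γ r k p * Γ.G l r
        - ∑ r, Pvsp N Γ l r p * Γ.G r k - ∑ r, Pvsp N Γ l k r * Γ.G r p := by
  simp [covT, sigPvsp, PvspT, Fin.sum_univ_succ, mul_sub, kron]
  ring

theorem covY_Rv1T (M : Fin n → Fn n) (N : Fin n → Fin n → Fn n) (Γ : Conn n) (l k p : Fin n) :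
    covY Γ sigVlS p (Rv1T M N) ![l, k]
      = py p (Rv1 M N l k) + ∑ r, Rv1 M N r k * Γ.C l r p - ∑ r, Rv1 M N l r * Γ.C r k p := by
  simp [covY, sigVlS, Rv1T, Fin.sum_univ_succ]
  ring

theorem covY_RvspT (M : Fin n → Fn n) (N : Fin n → Fin n → Fn n) (Γ : Conn n)
    (l j k p : Fin n) :
    covY Γ sigRvsp p (RvspT M N) ![l, j, k]
      = py p (Rvsp M N l j k) + ∑ r, Rvsp M N r j k * Γ.C l r p
        - ∑ r, Rvsp M N l r k * Γ.C r j p - ∑ r, Rvsp M N l j r * Γ.C r k p := by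
  simp [covY, sigRvsp, RvspT, Fin.sum_univ_succ]
  ring

end Jet

namespace Jet

/-- local Bianchi identities for an h-normal Γ-linear connection
of Cartan type. -/
theorem bianchi_identities_7_8
    (n : ℕ) (hn : 1 ≤ n)
    (h : ℝ → ℝ) (hh : ContDiff ℝ (⊤ : ℕ∞) h) (hhpos : ∀ t, 0 < h t)
    (M : Fin n → Fn n) (N : Fin n → Fin n → Fn n) (Γ : Conn n)
    (hκ : Γ.κ = chr h)
    (hMs : ∀ i, Smooth (M i)) (hNs : ∀ i j, Smooth (N i j))
    (hGs : ∀ k i, Smooth (Γ.G k i)) (hLs : ∀ k i j, Smooth (Γ.L k i j))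
    (hCs : ∀ k i j, Smooth (Γ.C k i j))
    (hLsym : ∀ k i j, Γ.L k i j = Γ.L k j i) (hCsym : ∀ k i j, Γ.C k i j = Γ.C k j i) :
    (∀ l k p,
      covX N Γ sigVlV k (Pv1T M Γ) ![l, p]
        - covT M Γ 0 sigPvsp (PvspT N Γ) ![l, k, p]
        + (∑ r, Pvsp N Γ l k r * Pv1 M Γ r p)
        - (∑ r, Pv1 M Γ l r * Pvsp N Γ r k p)
      = covY Γ sigVlS p (Rv1T M N) ![l, k]
        - Rc1 M N Γ l p k
        + (∑ r, Rv1 M N l r * Γ.C r k p)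
        - (∑ r, T1 Γ r k * Pvsp N Γ l r p))
    ∧ (∀ l j k p,
      (((∑ r, Rvsp M N l j r * Γ.C r k p)
          + (∑ r, Pvsp N Γ l j r * Pvsp N Γ r k p)
          + covX N Γ sigPvsp j (PvspT N Γ) ![l, k, p])
        - ((∑ r, Rvsp M N l k r * Γ.C r j p)
          + (∑ r, Pvsp N Γ l k r * Pvsp N Γ r j p)
          + covX N Γ sigPvsp k (PvspT N Γ) ![l, j, p]))
      = Rc M N Γ l p j k - covY Γ sigRvsp p (RvspT M N) ![l, j, k]) := by
  have hκs : Smooth Γ.κ := hκ ▸ smooth_chr hh hhpos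
  refine ⟨fun l k p => ?_, fun l j k p => ?_⟩
  · have hPv : dx N k (Pv1 M Γ l p) = dx N k (py p (M l)) - dx N k (Γ.G l p) := by
      rw [Pv1, dx_add _ _ (((hMs l).py p).sub (hGs l p)) ((Smooth.kron l p).mul hκs),
        dx_sub _ _ ((hMs l).py p) (hGs l p), hκ, dx_kron_mul_chr, add_zero]
    have hPvsp : dt M (Pvsp N Γ l k p) = dt M (py p (N l k)) - dt M (Γ.L l p k) :=
      dt_sub _ ((hNs l k).py p) (hLs l p k)
    have hRv : py p (Rv1 M N l k)
        = dx N k (py p (M l)) - ∑ r, py p (N r k) * py r (M l)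
          - (dt M (py p (N l k)) - ∑ r, py p (M r) * py r (N l k)) := by
      rw [Rv1, py_sub _ ((hMs l).dx hNs k) ((hNs l k).dt hMs), py_dx _ _ (hMs l) hNs,
        py_dt _ (hNs l k) hMs]
    have hC : ∑ r, Γ.C l p r * Rv1 M N r k = ∑ r, Rv1 M N r k * Γ.C l r p :=
      Finset.sum_congr rfl fun r _ => by rw [hCsym l p r, mul_comm]
    rw [covX_Pv1T, covT_PvspT, covY_Rv1T, hPv, hPvsp, hRv, Rc1, hC]
    simp only [Pv1, Pvsp, T1, kron, mul_add, add_mul, mul_sub, sub_mul, neg_mul, ite_mul, mul_ite,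
      one_mul, zero_mul, mul_zero, Finset.sum_add_distrib, Finset.sum_sub_distrib,
      Finset.sum_neg_distrib, Finset.sum_ite_eq, Finset.sum_ite_eq', Finset.mem_univ, if_true]
    simp only [mul_comm]
    ring
  · have hPvsp : ∀ i m, dx N i (Pvsp N Γ l m p)
        = dx N i (py p (N l m)) - dx N i (Γ.L l p m) := fun i m =>
      dx_sub _ _ ((hNs l m).py p) (hLs l p m)
    have hRv : py p (Rvsp M N l j k)
        = dx N k (py p (N l j)) - ∑ r, py p (N r k) * py r (N l j)
          - (dx N j (py p (N l k)) - ∑ r, py p (N r j) * py r (N l k)) := by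
      rw [Rvsp, py_sub _ ((hNs l j).dx hNs k) ((hNs l k).dx hNs j), py_dx _ _ (hNs l j) hNs,
        py_dx _ _ (hNs l k) hNs]
    have hC : ∑ r, Γ.C l p r * Rvsp M N r j k = ∑ r, Rvsp M N r j k * Γ.C l r p :=
      Finset.sum_congr rfl fun r _ => by rw [hCsym l p r, mul_comm]
    have hanti : ∑ r, Rvsp M N l r k * Γ.C r j p = -∑ r, Rvsp M N l k r * Γ.C r j p := by
      rw [← Finset.sum_neg_distrib]
      exact Finset.sum_congr rfl fun r _ => by unfold Rvsp; ring
    have hL : ∑ r, Pvsp N Γ l r p * Γ.L r k j = ∑ r, Pvsp N Γ l r p * Γ.L r j k :=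
      Finset.sum_congr rfl fun r _ => by rw [hLsym r k j]
    rw [covX_PvspT, covX_PvspT, covY_RvspT, hPvsp, hPvsp, hRv, Rc, hC, hanti, hL]
    simp only [Pvsp, mul_sub, sub_mul, Finset.sum_sub_distrib]
    simp only [mul_comm]
    ring

end Jet
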